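/- arXiv:2207.11241 — 4 statements merged into one kernel-verified Lean document; each statement's English description precedes it below -/
import Mathlib

section
/- Let n ≥ 1, let V ⊆ ℝⁿ be an open neighborhood of the origin that is invariant under permutations of coordinates, and let f : V → ℝ be an analytic function that is symmetric, i.e. f(x_{π⁻¹(1)},...,x_{π⁻¹(n)}) = f(x₁,...,xₙ) for every permutation π of {1,...,n} and every x ∈ V. Then there exist an open neighborhood U ⊆ V of the origin, an open neighborhood W ⊆ ℝⁿ of the origin with σ(U) ⊆ W, and an analytic function g : W → ℝ such that f(x) = g(σ(x)) for all x ∈ U; moreover g is unique in the sense that any two such analytic functions have the same Taylor series at the origin. -/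
open MvPolynomial

/-- The elementary symmetric polynomial map `σ = (σ¹, …, σⁿ) : ℝⁿ → ℝⁿ`. -/
noncomputable def elemSymmMap (n : ℕ) : (Fin n → ℝ) → (Fin n → ℝ) :=
  fun x k => MvPolynomial.eval x (MvPolynomial.esymm (Fin n) ℝ (k.1 + 1))

open Filter Topology

/-- Vieta's formula for the polynomial with roots `x₁, …, xₙ`, in terms of `elemSymmMap`. -/
theorem prod_sub_eq_add_sum_elemSymmMap {n : ℕ} (x : Fin n → ℝ) (z : ℝ) :
    ∏ i, (z - x i) =
      z ^ n + ∑ k : Fin n, (-1) ^ (k.1 + 1) * elemSymmMap n x k * z ^ (n - 1 - k.1) := by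
  have h := congrArg (Polynomial.eval z)
    (Multiset.prod_X_sub_X_eq_sum_esymm (Multiset.map x Finset.univ.val))
  rw [Polynomial.eval_multiset_prod, Polynomial.eval_finsetSum] at h
  simp only [Multiset.map_map, Multiset.card_map, Finset.card_val, Finset.card_univ,
    Fintype.card_fin] at h
  rw [Finset.sum_range_succ', Finset.sum_range] at h
  simp only [Function.comp_def, Polynomial.eval_sub, Polynomial.eval_X, Polynomial.eval_C,
    Polynomial.eval_mul, Polynomial.eval_pow, Polynomial.eval_neg, Polynomial.eval_one,
    ← MvPolynomial.aeval_esymm_eq_multiset_esymm (Fin n) ℝ, MvPolynomial.esymm_zero, map_one,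
    pow_zero, one_mul, Nat.sub_zero] at h
  rw [Finset.prod, h, add_comm]
  congr 1
  refine Finset.sum_congr rfl fun k _ => ?_
  rw [elemSymmMap, MvPolynomial.aeval_eq_eval, mul_assoc, Nat.sub_sub, add_comm 1]

theorem analyticOnNhd_elemSymmMap (n : ℕ) : AnalyticOnNhd ℝ (elemSymmMap n) Set.univ :=
  fun x _ => analyticAt_pi_iff.2 fun k =>
    AnalyticOnNhd.eval_mvPolynomial (MvPolynomial.esymm (Fin n) ℝ (k.1 + 1)) x (Set.mem_univ x)

theorem continuous_elemSymmMap (n : ℕ) : Continuous (elemSymmMap n) :=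
  continuousOn_univ.1 (analyticOnNhd_elemSymmMap n).continuousOn

theorem elemSymmMap_zero (n : ℕ) : elemSymmMap n 0 = 0 := by
  ext k
  simp only [elemSymmMap, Pi.zero_apply, MvPolynomial.esymm, map_sum, map_prod,
    MvPolynomial.eval_X]
  refine Finset.sum_eq_zero fun s hs => ?_
  rw [Finset.prod_const, (Finset.mem_powersetCard.1 hs).2, zero_pow k.1.succ_ne_zero]

/-- Points with pairwise distinct coordinates accumulate at every point along a line. -/
theorem eventually_injective_add_smul {n : ℕ} (x : Fin n → ℝ) :
    ∀ᶠ t : ℝ in 𝓝[≠] 0, Function.Injective (x + t • fun i : Fin n => (i.1 : ℝ)) := by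
  have key : ∀ i j : Fin n, i ≠ j →
      ∀ᶠ t : ℝ in 𝓝[≠] 0, x i + t * (i.1 : ℝ) ≠ x j + t * (j.1 : ℝ) := by
    intro i j hij
    have hne : (j.1 : ℝ) - i.1 ≠ 0 :=
      sub_ne_zero.2 fun h => hij (Fin.ext (Nat.cast_injective h).symm)
    have hfin : ({(x i - x j) / ((j.1 : ℝ) - i.1)} \ {0} : Set ℝ).Finite :=
      (Set.finite_singleton _).subset Set.sdiff_subset
    have hmem : ({(x i - x j) / ((j.1 : ℝ) - i.1)} \ {0} : Set ℝ)ᶜ ∈ 𝓝 (0 : ℝ) :=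
      hfin.isClosed.isOpen_compl.mem_nhds (by simp)
    filter_upwards [nhdsWithin_le_nhds hmem, self_mem_nhdsWithin] with t ht ht0 heq
    refine ht ⟨?_, ht0⟩
    rw [Set.mem_singleton_iff, eq_div_iff hne]
    linarith
  have hall : ∀ᶠ t : ℝ in 𝓝[≠] 0, ∀ i j : Fin n, i ≠ j →
      x i + t * (i.1 : ℝ) ≠ x j + t * (j.1 : ℝ) := by
    simpa only [eventually_all] using key
  filter_upwards [hall] with t ht i j hij
  by_contra hne
  exact ht i j hne (by simpa using hij)

theorem tendsto_add_smul_nhdsNE {n : ℕ} (x v : Fin n → ℝ) :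
    Tendsto (fun t : ℝ => x + t • v) (𝓝[≠] 0) (𝓝 x) := by
  have h : Continuous fun t : ℝ => x + t • v := by fun_prop
  simpa using (h.tendsto 0).mono_left nhdsWithin_le_nhds

/-- The elementary symmetric map is open at points with pairwise distinct coordinates. -/
theorem map_elemSymmMap_nhds {n : ℕ} {x : Fin n → ℝ} (hx : Function.Injective x) :
    Filter.map (elemSymmMap n) (𝓝 x) = 𝓝 (elemSymmMap n x) := by
  have hd := (analyticOnNhd_elemSymmMap n x (Set.mem_univ x)).hasStrictFDerivAt
  refine hd.map_nhds_eq_of_surj ?_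
  set L := fderiv ℝ (elemSymmMap n) x
  rw [LinearMap.range_eq_top, ← LinearMap.injective_iff_surjective, injective_iff_map_eq_zero]
  intro v hv
  ext i
  have hcoord : ∀ k, HasFDerivAt (fun y => elemSymmMap n y k)
      ((ContinuousLinearMap.proj k).comp L) x := fun k => hasFDerivAt_pi'.1 hd.hasFDerivAt k
  have hright : HasFDerivAt (fun y => x i ^ n + ∑ k : Fin n,
      (-1) ^ (k.1 + 1) * elemSymmMap n y k * x i ^ (n - 1 - k.1))
      (∑ k : Fin n, x i ^ (n - 1 - k.1) •
        ((-1 : ℝ) ^ (k.1 + 1) • (ContinuousLinearMap.proj k).comp L)) x :=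
    (HasFDerivAt.fun_sum fun k _ => ((hcoord k).const_mul _).mul_const _).const_add _
  have hleft : HasFDerivAt (fun y : Fin n → ℝ => ∏ j, (x i - y j))
      (∑ j, (∏ l ∈ Finset.univ.erase j, (x i - x l)) •
        (-ContinuousLinearMap.proj (R := ℝ) (φ := fun _ : Fin n => ℝ) j)) x :=
    HasFDerivAt.finsetProd fun j _ => (hasFDerivAt_apply j x).const_sub (x i)
  have heq := congrArg (fun A => A v)
    (hleft.unique (hright.congr_of_eventuallyEq
      (.of_forall fun y => prod_sub_eq_add_sum_elemSymmMap y (x i))))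
  have hv' : L v = 0 := hv
  simp only [sum_apply, smul_apply,
    ContinuousLinearMap.comp_apply, hv', map_zero,
    neg_apply, ContinuousLinearMap.proj_apply, smul_eq_mul] at heq
  rw [Finset.sum_eq_single i] at heq
  · have hprod : ∏ l ∈ Finset.univ.erase i, (x i - x l) ≠ 0 :=
      Finset.prod_ne_zero_iff.2 fun l hl =>
        sub_ne_zero.2 fun h => Finset.ne_of_mem_erase hl (hx h).symm
    simpa [hprod] using heq
  · intro j _ hj
    rw [Finset.prod_eq_zero (Finset.mem_erase.2 ⟨hj.symm, Finset.mem_univ i⟩) (sub_self _),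
      zero_mul]
  · simp

/-- Functions analytic at `0` whose pullbacks under the elementary symmetric map agree near `0`
agree near `0`. -/
theorem eventuallyEq_of_comp_elemSymmMap {n : ℕ} {g₁ g₂ : (Fin n → ℝ) → ℝ}
    (hg₁ : AnalyticAt ℝ g₁ 0) (hg₂ : AnalyticAt ℝ g₂ 0)
    (h : ∀ᶠ x in 𝓝 0, g₁ (elemSymmMap n x) = g₂ (elemSymmMap n x)) : g₁ =ᶠ[𝓝 0] g₂ := by
  obtain ⟨r, hr, hball⟩ := Metric.eventually_nhds_iff_ball.1
    (hg₁.eventually_analyticAt.and hg₂.eventually_analyticAt)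
  have hσ : Tendsto (elemSymmMap n) (𝓝 0) (𝓝 0) := by
    simpa only [elemSymmMap_zero] using (continuous_elemSymmMap n).tendsto 0
  have hline := tendsto_add_smul_nhdsNE (0 : Fin n → ℝ) (fun i => (i.1 : ℝ))
  obtain ⟨t, ht, htr, hinj⟩ := ((hline.eventually h.eventually_nhds).and
    ((hline.eventually (hσ.eventually (Metric.ball_mem_nhds 0 hr))).and
      (eventually_injective_add_smul 0))).exists
  have heq : g₁ =ᶠ[𝓝 (elemSymmMap n (0 + t • fun i : Fin n => (i.1 : ℝ)))] g₂ := by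
    rw [← map_elemSymmMap_nhds hinj]
    exact ht
  exact (AnalyticOnNhd.eqOn_of_preconnected_of_eventuallyEq (fun y hy => (hball y hy).1)
    (fun y hy => (hball y hy).2) (convex_ball 0 r).isPreconnected htr heq).eventuallyEq_of_mem
    (Metric.ball_mem_nhds 0 hr)

/-- The series obtained from a power series `p` in `n` real variables by substituting elements of
a Banach algebra, which need not commute, for the variables. -/
noncomputable def algebraSeries {n : ℕ} (p : FormalMultilinearSeries ℝ (Fin n → ℝ) ℝ)
    (A : Type*) [NormedRing A] [NormedAlgebra ℝ A] :
    FormalMultilinearSeries ℝ (Fin n → A) A := fun m =>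
  ∑ ι : Fin m → Fin n, p m (fun l => Pi.single (ι l) 1) •
    (ContinuousMultilinearMap.mkPiAlgebraFin ℝ m A).compContinuousLinearMap
      fun l => ContinuousLinearMap.proj (ι l)

theorem norm_algebraSeries_le {n : ℕ} (p : FormalMultilinearSeries ℝ (Fin n → ℝ) ℝ)
    (A : Type*) [NormedRing A] [NormedAlgebra ℝ A] [NormOneClass A] (m : ℕ) :
    ‖algebraSeries p A m‖ ≤ n ^ m * ‖p m‖ := by
  refine ContinuousMultilinearMap.opNorm_le_bound (by positivity) fun a => ?_
  have hterm : ∀ ι : Fin m → Fin n, ‖p m (fun l => Pi.single (ι l) 1) •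
      ContinuousMultilinearMap.mkPiAlgebraFin ℝ m A (fun l => a l (ι l))‖ ≤
      ‖p m‖ * ∏ l, ‖a l‖ := by
    intro ι
    have hp : ‖p m (fun l => Pi.single (ι l) 1)‖ ≤ ‖p m‖ := by
      refine ((p m).le_opNorm _).trans_eq ?_
      simp [Pi.norm_single]
    have hA : ‖ContinuousMultilinearMap.mkPiAlgebraFin ℝ m A (fun l => a l (ι l))‖ ≤
        ∏ l, ‖a l‖ := by
      refine (ContinuousMultilinearMap.le_opNorm _ _).trans ?_
      rw [ContinuousMultilinearMap.norm_mkPiAlgebraFin, one_mul]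
      gcongr with l
      exact norm_le_pi_norm (a l) (ι l)
    rw [norm_smul]
    gcongr
  rw [algebraSeries, sum_apply]
  refine (norm_sum_le_of_le _ fun ι _ => hterm ι).trans_eq ?_
  simp [mul_assoc]

theorem algebraSeries_radius_pos {n : ℕ} {p : FormalMultilinearSeries ℝ (Fin n → ℝ) ℝ}
    (hp : 0 < p.radius) (A : Type*) [NormedRing A] [NormedAlgebra ℝ A] [NormOneClass A] :
    0 < (algebraSeries p A).radius := by
  obtain ⟨r, hr0, hr⟩ := ENNReal.lt_iff_exists_nnreal_btwn.1 hp
  obtain ⟨C, -, hC⟩ := p.norm_mul_pow_le_of_lt_radius hr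
  have hr0 : 0 < r := by simpa using hr0
  have hpos : 0 < r / (n + 1) := by positivity
  refine lt_of_lt_of_le (ENNReal.coe_pos.2 hpos)
    ((algebraSeries p A).le_radius_of_bound C fun m => le_trans ?_ (hC m))
  have hn : (n : ℝ) * (r / (n + 1)) ≤ r := by
    rw [mul_div_assoc', div_le_iff₀ (by positivity)]
    nlinarith [r.coe_nonneg]
  calc ‖algebraSeries p A m‖ * ((r / (n + 1) : NNReal) : ℝ) ^ m
      ≤ (n ^ m * ‖p m‖) * ((r / (n + 1) : NNReal) : ℝ) ^ m := by
        gcongr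
        exact norm_algebraSeries_le p A m
    _ = ‖p m‖ * ((n : ℝ) * (r / (n + 1))) ^ m := by
        push_cast
        ring
    _ ≤ ‖p m‖ * r ^ m := by gcongr

theorem list_ofFn_prod_apply_eq_smul {T : Type*} [NormedAddCommGroup T] [NormedSpace ℝ T]
    {m : ℕ} {a : Fin m → T →L[ℝ] T} {c : Fin m → ℝ} {v : T} (h : ∀ l, a l v = c l • v) :
    (List.ofFn a).prod v = (∏ l, c l) • v := by
  induction m with
  | zero => simp
  | succ m ih =>
    rw [List.ofFn_succ, List.prod_cons, mul_apply_eq_comp, ih fun l => h l.succ,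
      map_smul, h, smul_smul, Fin.prod_univ_succ, mul_comm]

theorem algebraSeries_apply_eigenvector {n : ℕ} (p : FormalMultilinearSeries ℝ (Fin n → ℝ) ℝ)
    {T : Type*} [NormedAddCommGroup T] [NormedSpace ℝ T] {a : Fin n → T →L[ℝ] T}
    {y : Fin n → ℝ} {v : T} (h : ∀ i, a i v = y i • v) (m : ℕ) :
    algebraSeries p (T →L[ℝ] T) m (fun _ => a) v = p m (fun _ => y) • v := by
  have hy : (fun _ : Fin m => y) = fun _ => ∑ i, y i • (Pi.single i 1 : Fin n → ℝ) := by
    funext _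
    exact pi_eq_sum_univ' y
  rw [hy, ContinuousMultilinearMap.map_sum, Finset.sum_smul, algebraSeries,
    sum_apply, sum_apply]
  refine Finset.sum_congr rfl fun ι _ => ?_
  rw [ContinuousMultilinearMap.map_smul_univ (p m) (fun l => y (ι l)),
    smul_apply, smul_apply,
    ContinuousMultilinearMap.compContinuousLinearMap_apply,
    ContinuousMultilinearMap.mkPiAlgebraFin_apply]
  simp only [ContinuousLinearMap.proj_apply]
  rw [list_ofFn_prod_apply_eq_smul fun l => h (ι l), smul_smul, smul_eq_mul, mul_comm]

/-- Functional calculus on joint eigenvectors. -/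
theorem algebraSeries_sum_apply_eigenvector {n : ℕ} {f : (Fin n → ℝ) → ℝ}
    {p : FormalMultilinearSeries ℝ (Fin n → ℝ) ℝ} {R : ENNReal}
    (hf : HasFPowerSeriesOnBall f p 0 R)
    {T : Type*} [NormedAddCommGroup T] [NormedSpace ℝ T] [CompleteSpace T]
    {a : Fin n → T →L[ℝ] T} (ha : a ∈ Metric.eball 0 (algebraSeries p (T →L[ℝ] T)).radius)
    {y : Fin n → ℝ} (hy : y ∈ Metric.eball 0 R) {v : T} (h : ∀ i, a i v = y i • v) :
    (algebraSeries p (T →L[ℝ] T)).sum a v = f y • v := by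
  have h₁ := ((algebraSeries p (T →L[ℝ] T)).hasSum ha).mapL
    (ContinuousLinearMap.apply ℝ T v)
  have h₂ := (hf.hasSum hy).smul_const v
  rw [zero_add] at h₂
  refine h₁.unique ?_
  simpa only [ContinuousLinearMap.apply_apply, algebraSeries_apply_eigenvector p h] using h₂

/-- The companion matrix of the monic polynomial with signed coefficients `s`, conjugated by the
diagonal matrix with entries `ε ^ k`. -/
noncomputable def scaledCompanion (n : ℕ) (ε : ℝ) (s : Fin n → ℝ) : Fin n → Fin n → ℝ :=
  fun k l => if k.1 + 1 < n then (if l.1 = k.1 + 1 then ε else 0)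
    else (-1) ^ (n - 1 - l.1) * s l.rev * (ε ^ l.1 / ε ^ (n - 1))

theorem analyticAt_scaledCompanion {n : ℕ} (ε : ℝ) (s : Fin n → ℝ) :
    AnalyticAt ℝ (scaledCompanion n ε) s := by
  refine analyticAt_pi_iff.2 fun k => analyticAt_pi_iff.2 fun l => ?_
  unfold scaledCompanion
  by_cases hk : k.1 + 1 < n
  · simp only [hk, if_true]
    exact analyticAt_const
  · simp only [hk, if_false]
    exact (analyticAt_const.mul
      ((ContinuousLinearMap.proj (R := ℝ) (φ := fun _ : Fin n => ℝ) l.rev).analyticAt s)).mul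
      analyticAt_const

theorem scaledCompanion_eigenvector {n : ℕ} {ε : ℝ} (hε : ε ≠ 0) (x : Fin n → ℝ)
    (j k : Fin n) :
    ∑ l, scaledCompanion n ε (elemSymmMap n x) k l * (x j / ε) ^ l.1 =
      x j * (x j / ε) ^ k.1 := by
  unfold scaledCompanion
  by_cases hk : k.1 + 1 < n
  · rw [Finset.sum_eq_single ⟨k.1 + 1, hk⟩]
    · simp only [hk, if_true, pow_succ]
      field_simp
    · intro l _ hl
      simp [hk, show l.1 ≠ k.1 + 1 from fun h => hl (Fin.ext h)]
    · simp
  · have hroot := prod_sub_eq_add_sum_elemSymmMap x (x j)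
    rw [Finset.prod_eq_zero (Finset.mem_univ j) (sub_self _)] at hroot
    have hkn : k.1 = n - 1 := by omega
    have hn : n = n - 1 + 1 := by omega
    rw [← Equiv.sum_comp Fin.revPerm] at hroot
    simp only [hk, if_false]
    rw [hkn]
    have hterm : ∀ l : Fin n, (-1 : ℝ) ^ (n - 1 - l.1) * elemSymmMap n x l.rev *
        (ε ^ l.1 / ε ^ (n - 1)) * (x j / ε) ^ l.1 =
        -((-1) ^ ((Fin.revPerm l).1 + 1) * elemSymmMap n x (Fin.revPerm l) *
          x j ^ (n - 1 - (Fin.revPerm l).1)) / ε ^ (n - 1) := by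
      intro l
      have h₁ : (Fin.revPerm l).1 = n - 1 - l.1 := by
        rw [Fin.revPerm_apply, Fin.val_rev]
        omega
      have h₂ : n - 1 - (n - 1 - l.1) = l.1 := by omega
      rw [h₁, h₂, Fin.revPerm_apply, div_pow, pow_succ]
      field_simp
    rw [Finset.sum_congr rfl fun l _ => hterm l, ← Finset.sum_div, Finset.sum_neg_distrib,
      div_pow, ← mul_div_assoc, ← pow_succ', ← hn]
    congr 1
    linarith

/-- The action of a matrix on the `i`-th factor of `(ℝⁿ)^{⊗ n}`, whose elements are represented by
their coordinates. -/
noncomputable def tensorSlot {n : ℕ} (i : Fin n) :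
    (Fin n → Fin n → ℝ) →ₗ[ℝ] (((Fin n → Fin n) → ℝ) →L[ℝ] ((Fin n → Fin n) → ℝ)) where
  toFun M := LinearMap.toContinuousLinearMap
    { toFun := fun T φ => ∑ l, M (φ i) l * T (Function.update φ i l)
      map_add' := fun T T' => by
        ext φ
        simp [mul_add, Finset.sum_add_distrib]
      map_smul' := fun c T => by
        ext φ
        simp [Finset.mul_sum, mul_left_comm] }
  map_add' M M' := by
    ext T φ
    simp [add_mul, Finset.sum_add_distrib]
  map_smul' c M := by
    ext T φ
    simp [Finset.mul_sum, mul_assoc]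

theorem tensorSlot_apply {n : ℕ} (i : Fin n) (M : Fin n → Fin n → ℝ)
    (T : (Fin n → Fin n) → ℝ) (φ : Fin n → Fin n) :
    tensorSlot i M T φ = ∑ l, M (φ i) l * T (Function.update φ i l) := rfl

theorem tensorSlot_apply_prod {n : ℕ} {i : Fin n} {M : Fin n → Fin n → ℝ} {c : ℝ}
    {w : Fin n → Fin n → ℝ} (hw : ∀ k, ∑ l, M k l * w i l = c * w i k) :
    tensorSlot i M (fun φ => ∏ j, w j (φ j)) = c • fun φ => ∏ j, w j (φ j) := by
  ext φ
  rw [tensorSlot_apply, Pi.smul_apply, smul_eq_mul,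
    ← Finset.mul_prod_erase _ _ (Finset.mem_univ i), ← mul_assoc, ← hw, Finset.sum_mul]
  refine Finset.sum_congr rfl fun l _ => ?_
  rw [← Finset.mul_prod_erase _ _ (Finset.mem_univ i), Function.update_self, mul_assoc]
  congr 2
  refine Finset.prod_congr rfl fun j hj => ?_
  rw [Function.update_of_ne (Finset.ne_of_mem_erase hj)]

theorem norm_tensorSlot_scaledCompanion_zero_le {n : ℕ} {ε : ℝ} (hε : 0 ≤ ε) (i : Fin n) :
    ‖tensorSlot i (scaledCompanion n ε 0)‖ ≤ ε := by
  refine ContinuousLinearMap.opNorm_le_bound _ hε fun T =>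
    (pi_norm_le_iff_of_nonneg (by positivity)).2 fun φ => ?_
  rw [tensorSlot_apply]
  unfold scaledCompanion
  by_cases hk : (φ i).1 + 1 < n
  · rw [Finset.sum_eq_single ⟨(φ i).1 + 1, hk⟩]
    · simp only [hk, if_true, norm_mul, Real.norm_of_nonneg hε]
      exact mul_le_mul_of_nonneg_left (norm_le_pi_norm T _) hε
    · intro l _ hl
      simp [hk, show l.1 ≠ (φ i).1 + 1 from fun h => hl (Fin.ext h)]
    · simp
  · simp only [hk, if_false, Pi.zero_apply, mul_zero, zero_mul, Finset.sum_const_zero, norm_zero]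
    positivity

/-- The tuple of commuting operators given by the companion matrix acting on each tensor factor. -/
noncomputable def companionTuple (n : ℕ) (ε : ℝ) (s : Fin n → ℝ) :
    Fin n → ((Fin n → Fin n) → ℝ) →L[ℝ] ((Fin n → Fin n) → ℝ) :=
  fun i => tensorSlot i (scaledCompanion n ε s)

theorem analyticOnNhd_companionTuple (n : ℕ) (ε : ℝ) :
    AnalyticOnNhd ℝ (companionTuple n ε) Set.univ := fun s _ =>
  analyticAt_pi_iff.2 fun i =>
    ((LinearMap.toContinuousLinearMap (tensorSlot i)).analyticAt _).comp
      (analyticAt_scaledCompanion ε s)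

/-- The coordinates of the antisymmetrization of `w₁ ⊗ ⋯ ⊗ wₙ`. -/
noncomputable def wedge {n : ℕ} (w : Fin n → Fin n → ℝ) : (Fin n → Fin n) → ℝ :=
  ∑ π : Equiv.Perm (Fin n), (Equiv.Perm.sign π : ℝ) • fun φ => ∏ i, w (π i) (φ i)

theorem wedge_apply {n : ℕ} (w : Fin n → Fin n → ℝ) (φ : Fin n → Fin n) :
    wedge w φ = (Matrix.of fun j i => w j (φ i)).det := by
  simp [wedge, Matrix.det_apply', Finset.sum_apply]

theorem wedge_eq_det_smul {n : ℕ} (w : Fin n → Fin n → ℝ) :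
    wedge w = (Matrix.of w).det • wedge fun j => Pi.single j 1 := by
  ext φ
  rw [Pi.smul_apply, wedge_apply, wedge_apply, smul_eq_mul, ← Matrix.det_mul]
  congr 1
  ext j i
  simp [Matrix.mul_apply, Pi.single_apply]

theorem wedge_single_id (n : ℕ) : wedge (fun j : Fin n => Pi.single j (1 : ℝ)) id = 1 := by
  rw [wedge_apply]
  have h : (Matrix.of fun j i : Fin n => (Pi.single j (1 : ℝ) : Fin n → ℝ) (id i)) = 1 := by
    ext j i
    simp [Matrix.one_apply, Pi.single_apply, eq_comm]
  rw [h, Matrix.det_one]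

/-- The candidate factor: a matrix coefficient of `p` evaluated at the companion operators. -/
noncomputable def symmetricFactor {n : ℕ} (p : FormalMultilinearSeries ℝ (Fin n → ℝ) ℝ) (ε : ℝ)
    (s : Fin n → ℝ) : ℝ :=
  (algebraSeries p (((Fin n → Fin n) → ℝ) →L[ℝ] ((Fin n → Fin n) → ℝ))).sum
    (companionTuple n ε s) (wedge fun j => Pi.single j 1) id

theorem symmetricFactor_elemSymmMap {n : ℕ} {f : (Fin n → ℝ) → ℝ}
    {p : FormalMultilinearSeries ℝ (Fin n → ℝ) ℝ} {R : ENNReal}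
    (hf : HasFPowerSeriesOnBall f p 0 R) {ε : ℝ} (hε : ε ≠ 0) {x : Fin n → ℝ}
    (hx : Function.Injective x)
    (hsymm : ∀ π : Equiv.Perm (Fin n), f (fun i => x (π i)) = f x)
    (hxR : ∀ π : Equiv.Perm (Fin n), (fun i => x (π i)) ∈ Metric.eball 0 R)
    (ha : companionTuple n ε (elemSymmMap n x) ∈ Metric.eball 0 (algebraSeries p
      (((Fin n → Fin n) → ℝ) →L[ℝ] ((Fin n → Fin n) → ℝ))).radius) :
    symmetricFactor p ε (elemSymmMap n x) = f x := by
  set w : Fin n → Fin n → ℝ := Matrix.vandermonde fun j => x j / ε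
  have hdet : (Matrix.of w).det ≠ 0 := Matrix.det_vandermonde_ne_zero_iff.2
    fun i j hij => hx ((div_left_inj' hε).1 hij)
  have hterm : ∀ π : Equiv.Perm (Fin n), (algebraSeries p
      (((Fin n → Fin n) → ℝ) →L[ℝ] ((Fin n → Fin n) → ℝ))).sum
      (companionTuple n ε (elemSymmMap n x)) (fun φ => ∏ i, w (π i) (φ i)) =
      f x • fun φ => ∏ i, w (π i) (φ i) := by
    intro π
    rw [← hsymm π]
    refine algebraSeries_sum_apply_eigenvector hf ha (hxR π) fun i => ?_
    refine tensorSlot_apply_prod (w := fun i => w (π i)) fun k => ?_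
    exact scaledCompanion_eigenvector hε x (π i) k
  have hwedge : (algebraSeries p (((Fin n → Fin n) → ℝ) →L[ℝ] ((Fin n → Fin n) → ℝ))).sum
      (companionTuple n ε (elemSymmMap n x)) (wedge w) = f x • wedge w := by
    simp only [wedge, map_sum, map_smul, hterm, Finset.smul_sum, smul_comm (f x)]
  rw [wedge_eq_det_smul, map_smul, smul_comm] at hwedge
  have hcancel := congrFun (smul_right_injective _ hdet hwedge) id
  rw [Pi.smul_apply, wedge_single_id, smul_eq_mul, mul_one] at hcancel
  exact hcancel

/-- The set of parameters at which the series defining `symmetricFactor p ε` converges. -/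
def factorDomain {n : ℕ} (p : FormalMultilinearSeries ℝ (Fin n → ℝ) ℝ) (ε : ℝ) :
    Set (Fin n → ℝ) :=
  companionTuple n ε ⁻¹' Metric.eball 0 (algebraSeries p
    (((Fin n → Fin n) → ℝ) →L[ℝ] ((Fin n → Fin n) → ℝ))).radius

theorem isOpen_factorDomain {n : ℕ} (p : FormalMultilinearSeries ℝ (Fin n → ℝ) ℝ) (ε : ℝ) :
    IsOpen (factorDomain p ε) :=
  Metric.isOpen_eball.preimage
    (continuousOn_univ.1 (analyticOnNhd_companionTuple n ε).continuousOn)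

theorem exists_zero_mem_factorDomain {n : ℕ} {p : FormalMultilinearSeries ℝ (Fin n → ℝ) ℝ}
    (hp : 0 < p.radius) : ∃ ε : ℝ, ε ≠ 0 ∧ 0 ∈ factorDomain p ε := by
  have : Nonempty (Fin n → Fin n) := ⟨id⟩
  obtain ⟨ε, hε0, hε⟩ := ENNReal.lt_iff_exists_nnreal_btwn.1 (algebraSeries_radius_pos hp
    (((Fin n → Fin n) → ℝ) →L[ℝ] ((Fin n → Fin n) → ℝ)))
  refine ⟨ε, NNReal.coe_ne_zero.2 (ENNReal.coe_pos.1 hε0).ne', ?_⟩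
  have hnorm : ‖companionTuple n ε 0‖ ≤ ε := (pi_norm_le_iff_of_nonneg ε.coe_nonneg).2
    fun i => norm_tensorSlot_scaledCompanion_zero_le ε.coe_nonneg i
  rw [factorDomain, Set.mem_preimage, mem_eball_zero_iff]
  refine lt_of_le_of_lt ?_ hε
  exact ENNReal.coe_le_coe.2 hnorm

theorem analyticOnNhd_symmetricFactor {n : ℕ} (p : FormalMultilinearSeries ℝ (Fin n → ℝ) ℝ)
    (ε : ℝ) : AnalyticOnNhd ℝ (symmetricFactor p ε) (factorDomain p ε) := by
  intro s hs
  have hsum : AnalyticAt ℝ (fun s => (algebraSeries p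
      (((Fin n → Fin n) → ℝ) →L[ℝ] ((Fin n → Fin n) → ℝ))).sum (companionTuple n ε s)) s :=
    ((FormalMultilinearSeries.hasFPowerSeriesOnBall _
      (pos_of_gt (Metric.mem_eball.1 hs))).analyticAt_of_mem hs).comp
      (analyticOnNhd_companionTuple n ε s (Set.mem_univ s))
  have happly : AnalyticAt ℝ (fun s => (algebraSeries p
      (((Fin n → Fin n) → ℝ) →L[ℝ] ((Fin n → Fin n) → ℝ))).sum (companionTuple n ε s)
      (wedge fun j => Pi.single j 1)) s :=
    ((ContinuousLinearMap.apply ℝ ((Fin n → Fin n) → ℝ)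
      (wedge fun j => Pi.single j 1)).analyticAt _).comp hsum
  exact analyticAt_pi_iff.1 happly id

/-- Existence of an analytic factor of a symmetric analytic function through the elementary
symmetric map. -/
theorem exists_symmetric_factor {n : ℕ} {V : Set (Fin n → ℝ)} (hVopen : IsOpen V) (hV0 : 0 ∈ V)
    {f : (Fin n → ℝ) → ℝ} (hf : AnalyticOnNhd ℝ f V)
    (hfsymm : ∀ (π : Equiv.Perm (Fin n)), ∀ x ∈ V, f (fun i => x (π i)) = f x) :
    ∃ U W : Set (Fin n → ℝ), IsOpen U ∧ 0 ∈ U ∧ U ⊆ V ∧ IsOpen W ∧ 0 ∈ W ∧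
      elemSymmMap n '' U ⊆ W ∧
      ∃ g : (Fin n → ℝ) → ℝ, AnalyticOnNhd ℝ g W ∧
        ∀ x ∈ U, f x = g (elemSymmMap n x) := by
  obtain ⟨p, R, hp⟩ := hf 0 hV0
  obtain ⟨ε, hε, h0⟩ := exists_zero_mem_factorDomain hp.radius_pos
  have hUopen : IsOpen (V ∩ Metric.eball 0 R ∩ elemSymmMap n ⁻¹' factorDomain p ε) :=
    (hVopen.inter Metric.isOpen_eball).inter
      ((isOpen_factorDomain p ε).preimage (continuous_elemSymmMap n))
  refine ⟨V ∩ Metric.eball 0 R ∩ elemSymmMap n ⁻¹' factorDomain p ε, factorDomain p ε, hUopen,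
    ⟨⟨hV0, Metric.mem_eball_self hp.r_pos⟩, ?_⟩, fun x hx => hx.1.1, isOpen_factorDomain p ε, h0,
    Set.image_subset_iff.2 fun x hx => hx.2, symmetricFactor p ε,
    analyticOnNhd_symmetricFactor p ε, fun x hx => ?_⟩
  · rwa [Set.mem_preimage, elemSymmMap_zero]
  have hline := tendsto_add_smul_nhdsNE x (fun i => (i.1 : ℝ))
  have hlim₁ : Tendsto f (𝓝 x) (𝓝 (f x)) := (hf x hx.1.1).continuousAt
  have hg : AnalyticAt ℝ (symmetricFactor p ε) (elemSymmMap n x) :=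
    analyticOnNhd_symmetricFactor p ε (elemSymmMap n x) hx.2
  have hlim₂ : Tendsto (fun y => symmetricFactor p ε (elemSymmMap n y)) (𝓝 x)
      (𝓝 (symmetricFactor p ε (elemSymmMap n x))) :=
    (hg.continuousAt.tendsto).comp ((continuous_elemSymmMap n).tendsto x)
  refine tendsto_nhds_unique_of_eventuallyEq (hlim₁.comp hline) (hlim₂.comp hline) ?_
  filter_upwards [eventually_injective_add_smul x, hline.eventually (hUopen.mem_nhds hx)]
    with t hinj ht
  refine (symmetricFactor_elemSymmMap hp hε hinj
    (fun π => hfsymm π _ ht.1.1) (fun π => ?_) ht.2).symm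
  have hball := ht.1.2
  rw [mem_eball_zero_iff] at hball ⊢
  refine lt_of_le_of_lt (enorm_le_iff_norm_le.2 ?_) hball
  exact (pi_norm_le_iff_of_nonneg (norm_nonneg _)).2 fun i => norm_le_pi_norm _ (π i)

/-- The symmetric function theorem for analytic functions: a symmetric analytic function
`f` on a symmetric open neighborhood `V` of `0 ∈ ℝⁿ` factors, near the origin, as `g ∘ σ`
with `g` analytic; moreover any two such analytic factors have the same Taylor series at
the origin. -/
theorem symmetric_function_theorem_analytic (n : ℕ) (hn : 1 ≤ n)
    (V : Set (Fin n → ℝ)) (hVopen : IsOpen V) (hV0 : 0 ∈ V)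
    (hVsymm : ∀ (π : Equiv.Perm (Fin n)), ∀ x ∈ V, (fun i => x (π i)) ∈ V)
    (f : (Fin n → ℝ) → ℝ) (hf : AnalyticOnNhd ℝ f V)
    (hfsymm : ∀ (π : Equiv.Perm (Fin n)), ∀ x ∈ V, f (fun i => x (π i)) = f x) :
    (∃ U W : Set (Fin n → ℝ), IsOpen U ∧ 0 ∈ U ∧ U ⊆ V ∧ IsOpen W ∧ 0 ∈ W ∧
      elemSymmMap n '' U ⊆ W ∧
      ∃ g : (Fin n → ℝ) → ℝ, AnalyticOnNhd ℝ g W ∧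
        ∀ x ∈ U, f x = g (elemSymmMap n x)) ∧
    (∀ (U₁ W₁ U₂ W₂ : Set (Fin n → ℝ)) (g₁ g₂ : (Fin n → ℝ) → ℝ),
      IsOpen U₁ → 0 ∈ U₁ → U₁ ⊆ V → IsOpen W₁ → 0 ∈ W₁ → elemSymmMap n '' U₁ ⊆ W₁ →
      AnalyticOnNhd ℝ g₁ W₁ → (∀ x ∈ U₁, f x = g₁ (elemSymmMap n x)) →
      IsOpen U₂ → 0 ∈ U₂ → U₂ ⊆ V → IsOpen W₂ → 0 ∈ W₂ → elemSymmMap n '' U₂ ⊆ W₂ →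
      AnalyticOnNhd ℝ g₂ W₂ → (∀ x ∈ U₂, f x = g₂ (elemSymmMap n x)) →
      ∀ k : ℕ, iteratedFDeriv ℝ k g₁ 0 = iteratedFDeriv ℝ k g₂ 0) := by
  refine ⟨exists_symmetric_factor hVopen hV0 hf hfsymm, ?_⟩
  intro U₁ W₁ U₂ W₂ g₁ g₂ hU₁ hU₁0 _ _ hW₁0 _ hg₁ hfg₁ hU₂ hU₂0 _ _ hW₂0 _ hg₂ hfg₂ k
  refine ((eventuallyEq_of_comp_elemSymmMap (hg₁ 0 hW₁0) (hg₂ 0 hW₂0) ?_).iteratedFDeriv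
    ℝ k).eq_of_nhds
  filter_upwards [hU₁.mem_nhds hU₁0, hU₂.mem_nhds hU₂0] with x hx₁ hx₂
  rw [← hfg₁ x hx₁, ← hfg₂ x hx₂]
end

section
/- Let n ≥ 1 and let ν ∈ ℕⁿ satisfy ν₁ ≥ ν₂ ≥ ... ≥ νₙ, and set λ = φ(ν) = (ν₁−ν₂, ..., ν_{n−1}−νₙ, νₙ). Then the coefficient of the monomial x^ν in the polynomial σ^λ = ∏_{i=1}^n (σ^i)^{λᵢ} equals 1. -/
open MvPolynomial

/-- The map `φ(ν) = (ν₁−ν₂, …, ν_{n−1}−νₙ, νₙ)`. -/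
def phiMap (n : ℕ) (ν : Fin n → ℕ) : Fin n → ℕ :=
  fun i => if h : i.1 + 1 < n then ν i - ν ⟨i.1 + 1, h⟩ else ν i

theorem accumulate_phiMap (n : ℕ) (ν : Fin n → ℕ) (hν : Antitone ν) :
    Fin.accumulate n n (phiMap n ν) = ν := by
  have h : phiMap n ν = Fin.invAccumulate n n ν := by
    funext i
    by_cases hi : i.1 + 1 < n <;> simp [phiMap, Fin.invAccumulate, hi]
  rw [h, Fin.accumulate_invAccumulate le_rfl hν]

/-- For a non-increasing `ν` and `λ = φ(ν)`, the coefficient of `x^ν` in `σ^λ` is `1`. -/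
theorem coeff_self_esymm_prod_pow_phi (n : ℕ) (hn : 1 ≤ n) (ν : Fin n → ℕ)
    (hν : Antitone ν) :
    MvPolynomial.coeff (Finsupp.equivFunOnFinite.symm ν)
      (∏ i : Fin n, (MvPolynomial.esymm (Fin n) ℝ (i.1 + 1)) ^ (phiMap n ν i)) = 1 := by
  set t : Fin n →₀ ℕ := Finsupp.equivFunOnFinite.symm (phiMap n ν)
  have hprod : ∏ i : Fin n, (esymm (Fin n) ℝ (i.1 + 1)) ^ (phiMap n ν i) =
      esymmAlgHomMonomial (Fin n) t 1 := by
    rw [esymmAlgHomMonomial, esymmAlgHom_apply, aeval_monomial, map_one, one_mul,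
      Finsupp.prod_fintype _ _ fun _ => pow_zero _]
    rfl
  have hdeg : AddMonoidAlgebra.supDegree toLex (esymmAlgHomMonomial (Fin n) t (1 : ℝ)) =
      toLex (Finsupp.equivFunOnFinite.symm ν) := by
    apply ofLex.injective
    apply DFunLike.coe_injective
    rw [supDegree_esymmAlgHomMonomial one_ne_zero t le_rfl]
    exact accumulate_phiMap n ν hν
  have hlead := leadingCoeff_esymmAlgHomMonomial (R := ℝ) (r := 1) t (le_refl n)
  rw [AddMonoidAlgebra.leadingCoeff, hdeg,
    Function.leftInverse_invFun toLex.injective] at hlead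
  rw [hprod]
  exact hlead
end

section
/- Let n ≥ 1, d ≥ 1 and λ ∈ ℕⁿ. The coefficient of the monomial x₁^d in the polynomial σ^λ = ∏_{i=1}^n (σ^i)^{λᵢ} equals 1 if λ = (d,0,...,0) and equals 0 otherwise. Consequently, for any g ∈ ℝ[y₁,...,yₙ], the coefficient of x₁^d in g(σ¹,...,σⁿ) equals the coefficient of y₁^d in g. -/
open MvPolynomial

/-- The coefficient of `xᵢ^d` can be read off after setting all the other variables to zero. -/
theorem MvPolynomial.coeff_single_eq_coeff_aeval_piSingle {σ R : Type*} [CommSemiring R]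
    [DecidableEq σ] (i : σ) (d : ℕ) (p : MvPolynomial σ R) :
    coeff (Finsupp.single i d) p =
      (aeval (Pi.single i (Polynomial.X : Polynomial R)) p).coeff d := by
  induction p using MvPolynomial.induction_on' with
  | add p q hp hq => simp [hp, hq]
  | monomial u a =>
    rw [aeval_monomial, coeff_monomial, Polynomial.algebraMap_eq, Polynomial.coeff_C_mul]
    by_cases hu : ∃ j, j ≠ i ∧ u j ≠ 0
    · obtain ⟨j, hji, hj⟩ := hu
      have hne : u ≠ Finsupp.single i d := by
        rintro rfl
        exact hj (Finsupp.single_eq_of_ne hji)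
      rw [if_neg hne, Finsupp.prod,
        Finset.prod_eq_zero (Finsupp.mem_support_iff.mpr hj) (by simp [hji, hj])]
      simp
    · push Not at hu
      obtain ⟨e, rfl⟩ : ∃ e, u = Finsupp.single i e := by
        refine ⟨u i, Finsupp.ext fun j => ?_⟩
        by_cases hj : j = i
        · simp [hj]
        · simp [hu j hj, hj]
      rw [Finsupp.prod_single_index (by simp), Pi.single_eq_same, Polynomial.coeff_X_pow]
      simp [(Finsupp.single_injective i).eq_iff, eq_comm]

theorem MvPolynomial.aeval_piSingle_esymm_of_two_le {σ R S : Type*} [Fintype σ] [DecidableEq σ]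
    [CommSemiring R] [CommSemiring S] [Algebra R S] (i : σ) (x : S) {k : ℕ} (hk : 2 ≤ k) :
    aeval (Pi.single i x) (esymm σ R k) = 0 := by
  rw [esymm, map_sum]
  refine Finset.sum_eq_zero fun t ht => ?_
  rw [Finset.mem_powersetCard_univ] at ht
  obtain ⟨j, hjt, hji⟩ := Finset.exists_mem_ne (by omega : 1 < t.card) i
  rw [map_prod]
  exact Finset.prod_eq_zero hjt (by simp [hji])

/-- Setting all variables but the first to zero is unaffected by substituting the elementary
symmetric polynomials for the variables. -/
theorem MvPolynomial.aeval_piSingle_aeval_esymm {R S : Type*} [CommSemiring R] [CommSemiring S]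
    [Algebra R S] {n : ℕ} (hn : 0 < n) (x : S) (g : MvPolynomial (Fin n) R) :
    aeval (Pi.single (⟨0, hn⟩ : Fin n) x)
        (aeval (fun i : Fin n => esymm (Fin n) R (i.1 + 1)) g) =
      aeval (Pi.single (⟨0, hn⟩ : Fin n) x) g := by
  rw [← AlgHom.comp_apply]
  congr 1
  refine algHom_ext fun i => ?_
  rw [AlgHom.comp_apply, aeval_X, aeval_X]
  obtain ⟨_ | k, hi⟩ := i
  · simp
  · rw [aeval_piSingle_esymm_of_two_le _ _ (by simp), Pi.single_eq_of_ne (by simp)]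

/-- The coefficient of `x₁^d` in `σ^λ` is `1` if `λ = (d,0,…,0)` and `0` otherwise;
consequently the coefficient of `x₁^d` in `g(σ¹,…,σⁿ)` is the coefficient of `y₁^d`
in `g`. -/
theorem coeff_pow_first_var (n : ℕ) (hn : 1 ≤ n) (d : ℕ) (hd : 1 ≤ d) :
    (∀ l : Fin n →₀ ℕ,
      MvPolynomial.coeff (Finsupp.single (⟨0, hn⟩ : Fin n) d)
          (∏ i : Fin n, (MvPolynomial.esymm (Fin n) ℝ (i.1 + 1)) ^ (l i)) =
        if l = Finsupp.single (⟨0, hn⟩ : Fin n) d then 1 else 0) ∧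
    (∀ g : MvPolynomial (Fin n) ℝ,
      MvPolynomial.coeff (Finsupp.single (⟨0, hn⟩ : Fin n) d)
          (MvPolynomial.aeval (fun i : Fin n => MvPolynomial.esymm (Fin n) ℝ (i.1 + 1)) g) =
        MvPolynomial.coeff (Finsupp.single (⟨0, hn⟩ : Fin n) d) g) := by
  have coeff_aeval (g : MvPolynomial (Fin n) ℝ) :
      coeff (Finsupp.single (⟨0, hn⟩ : Fin n) d)
          (aeval (fun i : Fin n => esymm (Fin n) ℝ (i.1 + 1)) g) =
        coeff (Finsupp.single (⟨0, hn⟩ : Fin n) d) g := by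
    rw [coeff_single_eq_coeff_aeval_piSingle, aeval_piSingle_aeval_esymm,
      ← coeff_single_eq_coeff_aeval_piSingle]
  refine ⟨fun l => ?_, coeff_aeval⟩
  have h := coeff_aeval (monomial l 1)
  rwa [aeval_monomial, map_one, one_mul, Finsupp.prod_fintype _ _ (fun _ => pow_zero _),
    coeff_monomial] at h
end

section
/- Let n ≥ 2, d ≥ 2 and g ∈ ℝ[y₁,...,yₙ], and let f = g(σ¹,...,σⁿ). Then the coefficient of the monomial x₁^{d−1}x₂ in f equals d times the coefficient of y₁^d in g plus the coefficient of y₁^{d−2}y₂ in g. -/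
open MvPolynomial

namespace MvPolynomial

section

variable {σ R A : Type*} [CommSemiring R] [CommSemiring A] [Algebra R A]

/-- Evaluating an elementary symmetric polynomial at a point supported on `s` only involves
the subsets of `s`. -/
theorem aeval_esymm_of_support_subset [Fintype σ] (s : Finset σ) (h : σ → A)
    (hs : ∀ k ∉ s, h k = 0) (m : ℕ) :
    aeval h (esymm σ R m) = ∑ t ∈ s.powersetCard m, ∏ k ∈ t, h k := by
  rw [aeval_esymm_eq_multiset_esymm, Finset.esymm_map_val]
  refine (Finset.sum_subset (Finset.powersetCard_mono (Finset.subset_univ s)) ?_).symm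
  intro t ht hts
  obtain ⟨k, hkt, hks⟩ : ∃ k ∈ t, k ∉ s := by
    by_contra! hsub
    exact hts (Finset.mem_powersetCard.2 ⟨hsub, (Finset.mem_powersetCard.1 ht).2⟩)
  exact Finset.prod_eq_zero hkt (hs k hks)

theorem aeval_monomial_eq_zero (h : σ → A) (s : σ →₀ ℕ) (c : R) (k : σ) (hk : h k = 0)
    (hsk : s k ≠ 0) : aeval h (monomial s c) = 0 := by
  rw [aeval_monomial, Finsupp.prod,
    Finset.prod_eq_zero (Finsupp.mem_support_iff.2 hsk) (by rw [hk, zero_pow hsk]), mul_zero]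

theorem aeval_monomial_single_add_single (h : σ → A) (i j : σ) (a b : ℕ) (c : R) :
    aeval h (monomial (Finsupp.single i a + Finsupp.single j b) c) =
      c • (h i ^ a * h j ^ b) := by
  rw [aeval_monomial, Finsupp.prod_add_index' (by simp) (by simp [pow_add]),
    Finsupp.prod_single_index (by simp), Finsupp.prod_single_index (by simp), Algebra.smul_def]

theorem single_add_single_eq_iff {i j : σ} (hij : i ≠ j) {a b a' b' : ℕ} :
    Finsupp.single i a + Finsupp.single j b = Finsupp.single i a' + Finsupp.single j b' ↔
      a = a' ∧ b = b' := by
  refine ⟨fun h => ⟨?_, ?_⟩, by rintro ⟨rfl, rfl⟩; rfl⟩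
  · simpa [hij, hij.symm] using DFunLike.congr_fun h i
  · simpa [hij, hij.symm] using DFunLike.congr_fun h j

/-- An exponent vector either involves a variable other than `i`, `j`, or is supported on
these two. -/
theorem exists_ne_zero_or_eq_single_add_single {i j : σ} (hij : i ≠ j) (s : σ →₀ ℕ) :
    (∃ k, k ≠ i ∧ k ≠ j ∧ s k ≠ 0) ∨ ∃ a b, s = Finsupp.single i a + Finsupp.single j b := by
  refine or_iff_not_imp_left.2 fun hs => ⟨s i, s j, ?_⟩
  push Not at hs
  ext k
  by_cases hki : k = i
  · subst hki; simp [hij]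
  by_cases hkj : k = j
  · subst hkj; simp [hij]
  simp [hs k hki hkj, Ne.symm hki, Ne.symm hkj]

end

section

variable {σ R : Type*} [CommRing R]

/-- The coefficient of `xᵢᵈ xⱼ` can be read off after the substitution `xᵢ ↦ X`, `xⱼ ↦ ε`,
`xₖ ↦ 0` for all other `k`. -/
theorem coeff_snd_aeval_X_eps {i j : σ} (hij : i ≠ j) (h : σ → DualNumber (Polynomial R))
    (hi : h i = TrivSqZeroExt.inl Polynomial.X) (hj : h j = DualNumber.eps)
    (hk : ∀ k, k ≠ i → k ≠ j → h k = 0) (d : ℕ) (f : MvPolynomial σ R) :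
    (TrivSqZeroExt.snd (aeval h f)).coeff d =
      coeff (Finsupp.single i d + Finsupp.single j 1) f := by
  classical
  induction f using MvPolynomial.induction_on' with
  | add p q hp hq => simp [hp, hq]
  | monomial s c =>
    rcases exists_ne_zero_or_eq_single_add_single hij s with ⟨k, hki, hkj, hsk⟩ | ⟨a, b, rfl⟩
    · rw [aeval_monomial_eq_zero h s c k (hk k hki hkj) hsk, coeff_monomial, if_neg]
      · simp
      · rintro rfl
        simp [hki.symm, hkj.symm] at hsk
    · rw [aeval_monomial_single_add_single, coeff_monomial, hi, hj]
      simp only [single_add_single_eq_iff hij]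
      rcases b with _ | _ | b
      · simp
      · simp [Polynomial.coeff_X_pow, eq_comm]
      · simp [pow_succ, mul_assoc]

/-- Under `yᵢ ↦ X + ε`, `yⱼ ↦ X ε` and `yₖ ↦ 0` for all other `k`, the `ε`-part has
`X ^ (d + 1)`-coefficient determined by the coefficients of `yᵢ ^ (d + 2)` and `yᵢ ^ d yⱼ`. -/
theorem coeff_snd_aeval_X_add_eps {i j : σ} (hij : i ≠ j) (h : σ → DualNumber (Polynomial R))
    (hi : h i = TrivSqZeroExt.inl Polynomial.X + DualNumber.eps)
    (hj : h j = TrivSqZeroExt.inl Polynomial.X * DualNumber.eps)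
    (hk : ∀ k, k ≠ i → k ≠ j → h k = 0) (d : ℕ) (g : MvPolynomial σ R) :
    (TrivSqZeroExt.snd (aeval h g)).coeff (d + 1) =
      ((d + 2 : ℕ) : R) * coeff (Finsupp.single i (d + 2)) g +
        coeff (Finsupp.single i d + Finsupp.single j 1) g := by
  classical
  rw [← add_zero (Finsupp.single i (d + 2)), ← Finsupp.single_zero j]
  induction g using MvPolynomial.induction_on' with
  | add p q hp hq =>
    simp only [map_add, TrivSqZeroExt.snd_add, Polynomial.coeff_add, hp, hq, coeff_add]
    ring
  | monomial s c =>
    rcases exists_ne_zero_or_eq_single_add_single hij s with ⟨k, hki, hkj, hsk⟩ | ⟨a, b, rfl⟩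
    · rw [aeval_monomial_eq_zero h s c k (hk k hki hkj) hsk, coeff_monomial, coeff_monomial,
        if_neg, if_neg]
      · simp
      · rintro rfl
        simp [hki.symm, hkj.symm] at hsk
      · rintro rfl
        simp [hki.symm] at hsk
    · rw [aeval_monomial_single_add_single, coeff_monomial, coeff_monomial, hi, hj]
      simp only [single_add_single_eq_iff hij]
      rcases b with _ | _ | b
      · rcases a with _ | a
        · simp
        · have hsnd : TrivSqZeroExt.snd ((TrivSqZeroExt.inl Polynomial.X + DualNumber.eps :
              DualNumber (Polynomial R)) ^ (a + 1)) =
              Polynomial.C ((a + 1 : ℕ) : R) * Polynomial.X ^ a := by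
            simp [TrivSqZeroExt.snd_pow]
          rw [pow_zero, mul_one, TrivSqZeroExt.snd_smul, hsnd, Polynomial.coeff_smul,
            Polynomial.coeff_C_mul, Polynomial.coeff_X_pow]
          by_cases ha : a = d + 1
          · subst ha
            simp
            ring
          · simp [ha, Ne.symm ha]
      · simp [TrivSqZeroExt.fst_pow, ← pow_succ, Polynomial.coeff_X_pow, eq_comm]
      · have : (TrivSqZeroExt.inl Polynomial.X * DualNumber.eps : DualNumber (Polynomial R)) ^
            (b + 1 + 1) = 0 := by
          rw [mul_pow, pow_succ DualNumber.eps, pow_succ DualNumber.eps, mul_assoc _ DualNumber.eps,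
            DualNumber.eps_mul_eps, mul_zero, mul_zero]
        simp [this]

end

end MvPolynomial

/-- The coefficient of `x₁^{d−1}x₂` in `g(σ¹,…,σⁿ)` equals `d` times the coefficient of
`y₁^d` in `g` plus the coefficient of `y₁^{d−2}y₂` in `g`. -/
theorem coeff_x1_pow_x2 (n : ℕ) (hn : 2 ≤ n) (d : ℕ) (hd : 2 ≤ d)
    (g : MvPolynomial (Fin n) ℝ) :
    MvPolynomial.coeff
        (Finsupp.single (⟨0, by omega⟩ : Fin n) (d - 1) +
          Finsupp.single (⟨1, by omega⟩ : Fin n) 1)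
        (MvPolynomial.aeval (fun i : Fin n => MvPolynomial.esymm (Fin n) ℝ (i.1 + 1)) g) =
      d * MvPolynomial.coeff (Finsupp.single (⟨0, by omega⟩ : Fin n) d) g +
        MvPolynomial.coeff
          (Finsupp.single (⟨0, by omega⟩ : Fin n) (d - 2) +
            Finsupp.single (⟨1, by omega⟩ : Fin n) 1) g := by
  obtain ⟨d, rfl⟩ := Nat.exists_eq_add_of_le' hd
  have hij : (⟨0, by omega⟩ : Fin n) ≠ ⟨1, by omega⟩ := by simp
  generalize hi : (⟨0, by omega⟩ : Fin n) = i at hij ⊢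
  generalize hj : (⟨1, by omega⟩ : Fin n) = j at hij ⊢
  let h : Fin n → DualNumber (Polynomial ℝ) := fun k =>
    if k = i then TrivSqZeroExt.inl Polynomial.X else if k = j then DualNumber.eps else 0
  have h_i : h i = TrivSqZeroExt.inl Polynomial.X := if_pos rfl
  have h_j : h j = DualNumber.eps := by simp [h, hij.symm]
  have h_k : ∀ k, k ≠ i → k ≠ j → h k = 0 := fun k hki hkj => by simp [h, hki, hkj]
  have h_supp : ∀ k ∉ ({i, j} : Finset (Fin n)), h k = 0 := fun k hk => by
    simp only [Finset.mem_insert, Finset.mem_singleton, not_or] at hk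
    exact h_k k hk.1 hk.2
  have h_card : ({i, j} : Finset (Fin n)).card = 2 := Finset.card_pair hij
  rw [show d + 2 - 1 = d + 1 by omega, Nat.add_sub_cancel,
    ← coeff_snd_aeval_X_eps hij h h_i h_j h_k, ← AlgHom.comp_apply, comp_aeval]
  refine coeff_snd_aeval_X_add_eps hij _ ?_ ?_ ?_ d g
  · simp only [aeval_esymm_of_support_subset _ h h_supp, ← hi, zero_add, Finset.powersetCard_one]
    simp only [hi, Finset.sum_map, Finset.sum_pair hij]
    simp [h_i, h_j]
  · simp only [aeval_esymm_of_support_subset _ h h_supp, ← hj, Nat.reduceAdd]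
    simp only [hj]
    rw [← h_card, Finset.powersetCard_self, Finset.sum_singleton, Finset.prod_pair hij, h_i, h_j]
  · intro k hki hkj
    rw [aeval_esymm_of_support_subset _ h h_supp, Finset.powersetCard_eq_empty.2, Finset.sum_empty]
    rw [h_card]
    simp only [← hi, ← hj, ne_eq, Fin.ext_iff] at hki hkj
    omega
end
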